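/- arXiv:2603.14735 — 2 statements merged into one kernel-verified Lean document; each statement's English description precedes it below -/
import Mathlib

section
/- Let (L, ∘_λ, [·_λ·]) be a transposed Poisson conformal algebra. Then for all x, y, z, h ∈ L the identity [h_λ x]∘_{λ+γ}[y_{μ−γ} z] + [h_λ y]∘_{λ+μ−γ}[z_{−∂−γ} x] + [h_λ z]∘_{−∂−μ}[x_γ y] = 0 holds (as an identity of polynomials in λ, μ, γ with coefficients in L, where substitutions of the λ-variable by expressions involving ∂ are interpreted via the ℂ[∂]-module action). -/
/-!
We model a `ℂ[∂]`-module as a complex vector space `L` together with an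
endomorphism `D` (the action of `∂`).  A `λ`-product (or `λ`-bracket) is a
`ℂ`-bilinear map `L → L → L[λ]`, where the polynomial `x ∘_λ y = Σₙ λⁿ • cₙ`
is encoded by its finitely supported family of coefficients `ℕ →₀ L`.
Substitution of the variable `λ` by a complex scalar, or by an operator such
as `-∂-λ`, is given by `ev`; since `ℂ` is infinite, an identity of
polynomials in (several) variables `λ, μ, γ` with coefficients in a complex
vector space holds formally if and only if it holds for all complex values
of the variables, which is how all identities are stated below.
-/

namespace ConfFormal

variable {L : Type*} [AddCommGroup L] [Module ℂ L]

/-- Evaluation of a polynomial `p = Σₙ λⁿ • pₙ` with coefficients in `L`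
(encoded as the family of its coefficients) at an endomorphism `T` of `L`
(for instance at a scalar `λ`, or at an operator such as `-∂-λ`). -/
noncomputable def ev (T : Module.End ℂ L) (p : ℕ →₀ L) : L :=
  p.sum fun n x => (T ^ n) x

/-- `app m T x y` is `x ∘_T y` : the `λ`-product `x ∘_λ y` recorded by the
`ℂ`-bilinear coefficient map `m`, with the variable `λ` substituted by the
endomorphism `T`. -/
noncomputable def app (m : L →ₗ[ℂ] L →ₗ[ℂ] (ℕ →₀ L)) (T : Module.End ℂ L) (x y : L) : L :=
  ev T (m x y)

/-- The scalar `c` viewed as an endomorphism of `L`. -/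
noncomputable def sc (c : ℂ) : Module.End ℂ L := c • (1 : Module.End ℂ L)

/-- `(L, D, m)` is a conformal algebra: conformal sesquilinearity holds. -/
structure IsConfAlg (D : Module.End ℂ L) (m : L →ₗ[ℂ] L →ₗ[ℂ] (ℕ →₀ L)) : Prop where
  sesq_left : ∀ (x y : L) (l : ℂ), app m (sc l) (D x) y = -l • app m (sc l) x y
  sesq_right : ∀ (x y : L) (l : ℂ),
    app m (sc l) x (D y) = D (app m (sc l) x y) + l • app m (sc l) x y

/-- `(L, D, m)` is a commutative associative conformal algebra. -/
structure IsCommAssocConfAlg (D : Module.End ℂ L) (m : L →ₗ[ℂ] L →ₗ[ℂ] (ℕ →₀ L))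
    extends IsConfAlg D m : Prop where
  assoc : ∀ (x y z : L) (l u : ℂ),
    app m (sc l) x (app m (sc u) y z) = app m (sc (l + u)) (app m (sc l) x y) z
  comm : ∀ (x y : L) (l : ℂ), app m (sc l) x y = app m (-(D + sc l)) y x

/-- `(L, D, br)` is a Lie conformal algebra. -/
structure IsLieConfAlg (D : Module.End ℂ L) (br : L →ₗ[ℂ] L →ₗ[ℂ] (ℕ →₀ L)) : Prop where
  sesq_left : ∀ (x y : L) (l : ℂ), app br (sc l) (D x) y = -l • app br (sc l) x y
  skew : ∀ (x y : L) (l : ℂ), app br (sc l) x y = -app br (-(sc l + D)) y x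
  jacobi : ∀ (x y z : L) (l u : ℂ),
    app br (sc l) x (app br (sc u) y z) =
      app br (sc (l + u)) (app br (sc l) x y) z + app br (sc u) y (app br (sc l) x z)

/-- `(L, D, m, br)` is a transposed Poisson conformal algebra. -/
structure IsTPCA (D : Module.End ℂ L) (m br : L →ₗ[ℂ] L →ₗ[ℂ] (ℕ →₀ L)) : Prop where
  commAssoc : IsCommAssocConfAlg D m
  lie : IsLieConfAlg D br
  tLeibniz : ∀ (x y z : L) (l u : ℂ),
    (2 : ℂ) • app m (sc l) x (app br (sc u) y z) =
      app br (sc (l + u)) (app m (sc l) x y) z + app br (sc u) y (app m (sc l) x z)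


/-- Substitution of an endomorphism is linear in the polynomial. -/
noncomputable def evLin (T : Module.End ℂ L) : (ℕ →₀ L) →ₗ[ℂ] L :=
  Finsupp.lsum ℂ fun n => T ^ n

lemma ev_eq_evLin (T : Module.End ℂ L) (p : ℕ →₀ L) : ev T p = evLin T p := rfl

lemma ev_single (T : Module.End ℂ L) (n : ℕ) (a : L) :
    ev T (Finsupp.single n a) = (T ^ n) a := by
  simp [ev]

lemma ev_add (T : Module.End ℂ L) (p q : ℕ →₀ L) : ev T (p + q) = ev T p + ev T q := by
  simp [ev_eq_evLin]

lemma ev_zero (T : Module.End ℂ L) : ev T (0 : ℕ →₀ L) = 0 := by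
  simp [ev_eq_evLin]

lemma sc_apply (c : ℂ) (x : L) : sc c x = c • x := rfl

lemma sc_pow_apply (c : ℂ) (n : ℕ) (x : L) : ((sc c : Module.End ℂ L) ^ n) x = c ^ n • x := by
  simp [sc, smul_pow]

/-- The product `x ∘_T y` as a bilinear map. -/
noncomputable def appLin (m : L →ₗ[ℂ] L →ₗ[ℂ] (ℕ →₀ L)) (T : Module.End ℂ L) :
    L →ₗ[ℂ] L →ₗ[ℂ] L :=
  m.compr₂ (evLin T)

lemma app_eq_appLin (m : L →ₗ[ℂ] L →ₗ[ℂ] (ℕ →₀ L)) (T : Module.End ℂ L) (x y : L) :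
    app m T x y = appLin m T x y := rfl

lemma map_pow_apply_of_intertwines (f S T : Module.End ℂ L) (h : ∀ x, f (T x) = S (f x))
    (n : ℕ) (x : L) : f ((T ^ n) x) = (S ^ n) (f x) := by
  induction n with
  | zero => simp
  | succ k ih => rw [pow_succ', pow_succ', Module.End.mul_apply, Module.End.mul_apply, h, ih]

lemma map_ev_of_intertwines (f S T : Module.End ℂ L) (h : ∀ x, f (T x) = S (f x))
    (p : ℕ →₀ L) : f (ev T p) = ev S (Finsupp.mapRange.linearMap f p) := by
  induction p using Finsupp.induction_linear with
  | zero => simp [ev_zero]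
  | add p q hp hq => simp only [ev_add, map_add, hp, hq]
  | single n a =>
    simp only [Finsupp.mapRange.linearMap_apply, Finsupp.mapRange_single, ev_single]
    exact map_pow_apply_of_intertwines f S T h n a

lemma ev_mapDomain_add (T : Module.End ℂ L) (n : ℕ) (p : ℕ →₀ L) :
    ev T (Finsupp.mapDomain (n + ·) p) = (T ^ n) (ev T p) := by
  induction p using Finsupp.induction_linear with
  | zero => simp [ev_zero]
  | add p q hp hq => simp only [ev_add, Finsupp.mapDomain_add, map_add, hp, hq]
  | single k a => simp only [Finsupp.mapDomain_single, ev_single, pow_add, Module.End.mul_apply]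

/-- A polynomial vanishing at all scalars is zero. -/
lemma eq_zero_of_forall_ev_sc (p : ℕ →₀ L) (h : ∀ l : ℂ, ev (sc l) p = 0) : p = 0 := by
  ext n
  rw [Finsupp.zero_apply, ← Module.forall_dual_apply_eq_zero_iff ℂ]
  intro φ
  have hP : ∑ i ∈ p.support, Polynomial.monomial i (φ (p i)) = 0 := by
    refine Polynomial.funext fun l => ?_
    have hl := congrArg φ (h l)
    simp only [ev, Finsupp.sum, sc_pow_apply, map_sum, map_smul, map_zero, smul_eq_mul] at hl
    simpa [Polynomial.eval_finsetSum, mul_comm] using hl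
  have hn := congrArg (Polynomial.coeff · n) hP
  simp only [Polynomial.finsetSum_coeff, Polynomial.coeff_monomial, Finset.sum_ite_eq',
    Polynomial.coeff_zero] at hn
  by_cases hpn : p n = 0
  · rw [hpn, map_zero]
  · rwa [if_pos (Finsupp.mem_support_iff.mpr hpn)] at hn

/-- The function `F` of a scalar is polynomial, and `v` is obtained from it by substituting the
endomorphism `S` for the variable. -/
def SubstAt (S : Module.End ℂ L) (F : ℂ → L) (v : L) : Prop :=
  ∃ p : ℕ →₀ L, (∀ l, F l = ev (sc l) p) ∧ v = ev S p

namespace SubstAt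

variable {S : Module.End ℂ L} {F G : ℂ → L} {v w : L}

lemma unique (h₁ : SubstAt S F v) (h₂ : SubstAt S F w) : v = w := by
  obtain ⟨p, hp, rfl⟩ := h₁
  obtain ⟨q, hq, rfl⟩ := h₂
  have : p - q = 0 := eq_zero_of_forall_ev_sc _ fun l => by
    rw [ev_eq_evLin, map_sub, ← ev_eq_evLin, ← ev_eq_evLin, ← hp, ← hq, sub_self]
  rw [sub_eq_zero.mp this]

lemma app (m : L →ₗ[ℂ] L →ₗ[ℂ] (ℕ →₀ L)) (x y : L) :
    SubstAt S (fun l => app m (sc l) x y) (ConfFormal.app m S x y) :=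
  ⟨m x y, fun _ => rfl, rfl⟩

lemma const (x : L) : SubstAt S (fun _ => x) x :=
  ⟨Finsupp.single 0 x, by simp [ev_single], by simp [ev_single]⟩

lemma add (h₁ : SubstAt S F v) (h₂ : SubstAt S G w) :
    SubstAt S (fun l => F l + G l) (v + w) := by
  obtain ⟨p, hp, rfl⟩ := h₁
  obtain ⟨q, hq, rfl⟩ := h₂
  exact ⟨p + q, fun l => by simp only [hp, hq, ev_add], by rw [ev_add]⟩

lemma map (f : Module.End ℂ L) (hf : ∀ x, f (S x) = S (f x)) (h : SubstAt S F v) :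
    SubstAt S (fun l => f (F l)) (f v) := by
  obtain ⟨p, hp, rfl⟩ := h
  refine ⟨Finsupp.mapRange.linearMap f p, fun l => ?_, map_ev_of_intertwines f S S hf p⟩
  simp only [hp]
  exact map_ev_of_intertwines f _ _ (fun x => by simp [sc_apply]) p

lemma smul (c : ℂ) (h : SubstAt S F v) : SubstAt S (fun l => c • F l) (c • v) :=
  h.map (sc c) fun x => by simp [sc_apply]

lemma pow_smul (n : ℕ) (h : SubstAt S F v) :
    SubstAt S (fun l => l ^ n • F l) ((S ^ n) v) := by
  obtain ⟨p, hp, rfl⟩ := h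
  exact ⟨Finsupp.mapDomain (n + ·) p,
    fun l => by simp only [hp, ev_mapDomain_add, sc_pow_apply], (ev_mapDomain_add S n p).symm⟩

end SubstAt

lemma substAt_ev_neg_sc_add (D : Module.End ℂ L) (b c : ℂ) (q : ℕ →₀ L) :
    SubstAt (-(D + sc (b + c))) (fun l => ev (-(sc (l + b) + D)) q) (ev (sc c) q) := by
  induction q using Finsupp.induction_linear with
  | zero => simpa only [ev_zero] using SubstAt.const 0
  | add p q hp hq => simpa only [ev_add] using hp.add hq
  | single n a =>
    simp only [ev_single]
    induction n with
    | zero => simpa using SubstAt.const a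
    | succ n ih =>
      have h := ((ih.pow_smul 1).smul (-1)).add ((ih.smul (-b)).add ((ih.map D fun x => by
        simp [sc_apply]).smul (-1)))
      convert h using 1
      · funext l
        rw [pow_succ', Module.End.mul_apply]
        simp only [LinearMap.neg_apply, LinearMap.add_apply, sc_apply]
        module
      · rw [pow_succ', Module.End.mul_apply]
        simp only [LinearMap.neg_apply, LinearMap.add_apply, sc_apply, pow_one]
        module

/-- A map turning `T` into the scalar `c` turns substitution of `T` into substitution of `c`. -/
lemma map_ev_eq_map_ev_sc (f T : Module.End ℂ L) (c : ℂ) (h : ∀ x, f (T x) = c • f x)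
    (p : ℕ →₀ L) : f (ev T p) = f (ev (sc c) p) := by
  rw [map_ev_of_intertwines f (sc c) T h,
    map_ev_of_intertwines f (sc c) (sc c) fun x => by simp [sc_apply]]

lemma app_app_neg (D : Module.End ℂ L) (P Q : L →ₗ[ℂ] L →ₗ[ℂ] (ℕ →₀ L))
    (hP : ∀ (x y : L) (l : ℂ), app P (sc l) (D x) y = -l • app P (sc l) x y)
    (x y z : L) (b c : ℂ) :
    app P (sc (b + c)) (app Q (-(D + sc b)) y x) z
      = app P (sc (b + c)) (app Q (sc c) y x) z := by
  refine map_ev_eq_map_ev_sc ((appLin P (sc (b + c))).flip z) _ c (fun t => ?_) (Q y x)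
  have := hP t z (b + c)
  simp only [app_eq_appLin] at this
  simp only [LinearMap.flip_apply, LinearMap.neg_apply, LinearMap.add_apply, sc_apply, map_neg,
    map_add, map_smul, this]
  module

lemma IsLieConfAlg.sesq_right {D : Module.End ℂ L} {br : L →ₗ[ℂ] L →ₗ[ℂ] (ℕ →₀ L)}
    (h : IsLieConfAlg D br) (x y : L) (l : ℂ) :
    app br (sc l) x (D y) = D (app br (sc l) x y) + l • app br (sc l) x y := by
  have key : app br (-(sc l + D)) (D y) x
      = (-1 : ℂ) • (-(sc l + D) : Module.End ℂ L) (app br (-(sc l + D)) y x) := by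
    refine (SubstAt.app br (D y) x).unique ?_
    convert ((SubstAt.app br y x).pow_smul 1).smul (-1) using 1
    · funext k
      rw [h.sesq_left]
      module
    · rw [pow_one]
  rw [h.skew x (D y), key, h.skew x y]
  simp only [LinearMap.neg_apply, LinearMap.add_apply, sc_apply, map_neg]
  module

lemma substAt_app_add {D : Module.End ℂ L} {br : L →ₗ[ℂ] L →ₗ[ℂ] (ℕ →₀ L)}
    (h : IsLieConfAlg D br) (b c : ℂ) (y : L) (t : ℕ →₀ L) :
    SubstAt (-(D + sc (b + c))) (fun l => app br (sc (l + b)) (ev (sc l) t) y)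
      ((-1 : ℂ) • app br (sc c) y (ev (-(D + sc b)) t)) := by
  induction t using Finsupp.induction_linear with
  | zero => simpa [ev_zero, app_eq_appLin] using SubstAt.const 0
  | add p q hp hq =>
    simpa only [ev_add, app_eq_appLin, map_add, LinearMap.add_apply, smul_add] using hp.add hq
  | single n a =>
    have h₁ := ((substAt_ev_neg_sc_add D b c (br y a)).smul (-1)).pow_smul n
    convert h₁ using 1
    · funext l
      have := h.skew a y (l + b)
      simp only [app_eq_appLin] at this
      simp only [ev_single, sc_pow_apply, app_eq_appLin, map_smul, LinearMap.smul_apply, this]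
      simp only [← app_eq_appLin, app]
      module
    · rw [ev_single, map_smul]
      congr 1
      refine map_pow_apply_of_intertwines (appLin br (sc c) y) _ _ (fun x => ?_) n a
      have := h.sesq_right y x c
      simp only [app_eq_appLin] at this
      simp only [LinearMap.neg_apply, LinearMap.add_apply, sc_apply, map_neg, map_add, map_smul,
        this]
      module

lemma substAt_app_right {D : Module.End ℂ L} {br : L →ₗ[ℂ] L →ₗ[ℂ] (ℕ →₀ L)}
    (h : IsLieConfAlg D br) (b c : ℂ) (x : L) (t : ℕ →₀ L) :
    SubstAt (-(D + sc (b + c))) (fun l => app br (sc b) x (ev (sc l) t))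
      (app br (sc b) x (ev (-(D + sc c)) t)) := by
  refine ⟨Finsupp.mapRange.linearMap (appLin br (sc b) x) t,
    fun l => map_ev_of_intertwines (appLin br (sc b) x) _ _ (fun a => by simp [sc_apply]) t,
    map_ev_of_intertwines (appLin br (sc b) x) _ _ (fun a => ?_) t⟩
  have := h.sesq_right x a b
  simp only [app_eq_appLin] at this
  simp only [LinearMap.neg_apply, LinearMap.add_apply, sc_apply, map_neg, map_add, map_smul, this]
  module

namespace IsTPCA

variable {D : Module.End ℂ L} {m br : L →ₗ[ℂ] L →ₗ[ℂ] (ℕ →₀ L)}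

/-- The transposed Leibniz rule for multiplication of a bracket by an element on the right. -/
lemma tLeibniz_right (hT : IsTPCA D m br) (x y w : L) (b c : ℂ) :
    (2 : ℂ) • app m (sc (b + c)) (app br (sc b) x y) w
      = app br (sc b) x (app m (sc c) y w) - app br (sc c) y (app m (sc b) x w) := by
  rw [hT.commAssoc.comm _ w, hT.commAssoc.comm y w, hT.commAssoc.comm x w]
  have h := (substAt_app_add hT.lie b c y (m w x)).add (substAt_app_right hT.lie b c x (m w y))
  refine ((SubstAt.app m w (app br (sc b) x y)).smul 2).unique ?_
  convert h using 1
  · funext l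
    exact hT.tLeibniz w x y l b
  · simp only [app]
    module

lemma app_app_comm (hT : IsTPCA D m br) (x y z : L) (b c : ℂ) :
    app br (sc (b + c)) (app m (sc b) x y) z = app br (sc (b + c)) (app m (sc c) y x) z := by
  rw [hT.commAssoc.comm x y, app_app_neg D br m hT.lie.sesq_left]

/-- The conformal form of `x[y, z] + y[z, x] + z[x, y] = 0`. -/
lemma cyclic_mul_bracket (hT : IsTPCA D m br) (x y z : L) (b c : ℂ) :
    app m (sc b) x (app br (sc c) y z) - app m (sc c) y (app br (sc b) x z)
      + app m (sc (b + c)) (app br (sc b) x y) z = 0 := by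
  have h₁ := hT.tLeibniz x y z b c
  have h₂ := hT.tLeibniz y x z c b
  have h₃ := hT.tLeibniz_right x y z b c
  rw [hT.app_app_comm x y z b c] at h₁
  rw [add_comm c b] at h₂
  refine (smul_eq_zero_iff_right (two_ne_zero : (2 : ℂ) ≠ 0)).mp ?_
  rw [smul_add, smul_sub, h₁, h₂, h₃]
  abel

/-- The conformal form of `[h, x][y, z] + [h, y][z, x] + [h, z][x, y] = 0`. -/
lemma cyclic_bracket_mul_bracket (hT : IsTPCA D m br) (h x y z : L) (a b c : ℂ) :
    app m (sc (a + b)) (app br (sc a) h x) (app br (sc c) y z)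
      - app m (sc (a + c)) (app br (sc a) h y) (app br (sc b) x z)
      + app m (sc (b + c)) (app br (sc b) x y) (app br (sc a) h z) = 0 := by
  have p₁ := hT.tLeibniz (app br (sc a) h x) y z (a + b) c
  have p₂ := hT.tLeibniz (app br (sc a) h y) x z (a + c) b
  have p₃ := hT.tLeibniz_right x y (app br (sc a) h z) b c
  have q₁ := hT.tLeibniz_right h x (app br (sc c) y z) a b
  have q₂ := hT.tLeibniz_right h y (app br (sc b) x z) a c
  have q₃ := hT.tLeibniz (app br (sc b) x y) h z (b + c) a
  rw [hT.app_app_comm _ x z] at p₂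
  rw [hT.app_app_comm _ h z] at q₃
  rw [show a + c + b = a + b + c by ring] at p₂
  rw [show b + c + a = a + b + c by ring] at q₃
  have e₁ := congrArg (fun t => app br (sc (a + b + c)) t z) (hT.cyclic_mul_bracket h x y a b)
  have e₂ := congrArg (app br (sc c) y) (hT.cyclic_mul_bracket h x z a b)
  have e₃ := congrArg (app br (sc b) x) (hT.cyclic_mul_bracket h y z a c)
  have e₄ := congrArg (app br (sc a) h) (hT.cyclic_mul_bracket x y z b c)
  simp only [app_eq_appLin, map_add, map_sub, map_zero, LinearMap.add_apply, LinearMap.sub_apply,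
    LinearMap.zero_apply] at *
  refine (smul_eq_zero_iff_right (by norm_num : (4 : ℂ) ≠ 0)).mp ?_
  linear_combination (norm := module) p₁ - p₂ + p₃ + q₁ - q₂ + q₃ + e₁ + e₂ - e₃ + e₄

end IsTPCA

/-- In a transposed Poisson conformal algebra,
`[h_λ x]∘_{λ+γ}[y_{μ−γ} z] + [h_λ y]∘_{λ+μ−γ}[z_{−∂−γ} x]
  + [h_λ z]∘_{−∂−μ}[x_γ y] = 0`. -/
theorem tpca_identity_eql {L : Type*} [AddCommGroup L] [Module ℂ L]
    (D : Module.End ℂ L) (m br : L →ₗ[ℂ] L →ₗ[ℂ] (ℕ →₀ L))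
    (hT : IsTPCA D m br) :
    ∀ (x y z h : L) (l u g : ℂ),
      app m (sc (l + g)) (app br (sc l) h x) (app br (sc (u - g)) y z)
        + app m (sc (l + u - g)) (app br (sc l) h y) (app br (-(D + sc g)) z x)
        + app m (-(D + sc u)) (app br (sc l) h z) (app br (sc g) x y) = 0 := by
  intro x y z h l u g
  have key := hT.cyclic_bracket_mul_bracket h x y z l g (u - g)
  have hzx : app br (-(D + sc g)) z x = -app br (sc g) x z := by
    rw [hT.lie.skew x z, add_comm (sc g) D, neg_neg]
  rw [hzx, ← hT.commAssoc.comm _ _ u, app_eq_appLin m _ _ (-_), map_neg, ← app_eq_appLin]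
  rw [show l + (u - g) = l + u - g by ring, show g + (u - g) = u by ring] at key
  rwa [← sub_eq_add_neg]

end ConfFormal
end

section
/- Let (L, ∘_λ, [·_λ·]) be a transposed Poisson conformal algebra. For h ∈ L define the linear map α_h : L → L by α_h(x) = (h∘_λ x)|_{λ=0}, the evaluation of the polynomial h∘_λ x at λ = 0. Then (L, [·_λ·], α_h) is a Hom-Lie conformal algebra; in particular α_h commutes with ∂ and the Hom-Jacobi identity [α_h(a)_λ[b_μ c]] = [[a_λ b]_{λ+μ} α_h(c)] + [α_h(b)_μ[a_λ c]] holds for all a, b, c ∈ L. -/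
/-!
We model a `ℂ[∂]`-module as a complex vector space `L` together with an
endomorphism `D` (the action of `∂`).  A `λ`-product (or `λ`-bracket) is a
`ℂ`-bilinear map `L → L → L[λ]`, where the polynomial `x ∘_λ y = Σₙ λⁿ • cₙ`
is encoded by its finitely supported family of coefficients `ℕ →₀ L`.
Substitution of the variable `λ` by a complex scalar, or by an operator such
as `-∂-λ`, is given by `ev`; since `ℂ` is infinite, an identity of
polynomials in (several) variables `λ, μ, γ` with coefficients in a complex
vector space holds formally if and only if it holds for all complex values
of the variables, which is how all identities are stated below.
-/

namespace ConfFormal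

variable {L : Type*} [AddCommGroup L] [Module ℂ L]

/-- `(L, D, br, α)` is a Hom-Lie conformal algebra. -/
structure IsHomLieConfAlg (D : Module.End ℂ L) (br : L →ₗ[ℂ] L →ₗ[ℂ] (ℕ →₀ L))
    (α : L → L) : Prop where
  map_add : ∀ x y : L, α (x + y) = α x + α y
  map_smul : ∀ (c : ℂ) (x : L), α (c • x) = c • α x
  comm_D : ∀ x : L, α (D x) = D (α x)
  sesq_left : ∀ (x y : L) (l : ℂ), app br (sc l) (D x) y = -l • app br (sc l) x y
  skew : ∀ (x y : L) (l : ℂ), app br (sc l) x y = -app br (-(sc l + D)) y x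
  homJacobi : ∀ (x y z : L) (l u : ℂ),
    app br (sc l) (α x) (app br (sc u) y z) =
      app br (sc (l + u)) (app br (sc l) x y) (α z) + app br (sc u) (α y) (app br (sc l) x z)

lemma app_eq_lsum (m : L →ₗ[ℂ] L →ₗ[ℂ] (ℕ →₀ L)) (T : Module.End ℂ L) (x y : L) :
    app m T x y = Finsupp.lsum ℂ (fun n => T ^ n) (m x y) := rfl

lemma app_add_right (m : L →ₗ[ℂ] L →ₗ[ℂ] (ℕ →₀ L)) (T : Module.End ℂ L) (x y z : L) :
    app m T x (y + z) = app m T x y + app m T x z := by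
  simp only [app_eq_lsum, map_add]

lemma app_smul_right (m : L →ₗ[ℂ] L →ₗ[ℂ] (ℕ →₀ L)) (T : Module.End ℂ L) (c : ℂ) (x y : L) :
    app m T x (c • y) = c • app m T x y := by
  simp only [app_eq_lsum, map_smul]

lemma app_add_left (m : L →ₗ[ℂ] L →ₗ[ℂ] (ℕ →₀ L)) (T : Module.End ℂ L) (x y z : L) :
    app m T (x + y) z = app m T x z + app m T y z := by
  simp only [app_eq_lsum, map_add, LinearMap.add_apply]

lemma app_smul_left (m : L →ₗ[ℂ] L →ₗ[ℂ] (ℕ →₀ L)) (T : Module.End ℂ L) (c : ℂ) (x y : L) :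
    app m T (c • x) y = c • app m T x y := by
  simp only [app_eq_lsum, map_smul, LinearMap.smul_apply]

/-- If `α` is additive and `2 α [y_u z] = [α y_u z] + [y_u α z]` for a bracket satisfying the
Jacobi identity, then the bracket satisfies the Hom-Jacobi identity with respect to `α`. -/
lemma IsLieConfAlg.homJacobi_of_leibniz {D : Module.End ℂ L} {br : L →ₗ[ℂ] L →ₗ[ℂ] (ℕ →₀ L)}
    (hL : IsLieConfAlg D br) {α : L → L} (hadd : ∀ x y, α (x + y) = α x + α y)
    (hα : ∀ (y z : L) (u : ℂ), (2 : ℂ) • α (app br (sc u) y z) =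
      app br (sc u) (α y) z + app br (sc u) y (α z)) (x y z : L) (l u : ℂ) :
    app br (sc l) (α x) (app br (sc u) y z) =
      app br (sc (l + u)) (app br (sc l) x y) (α z) +
        app br (sc u) (α y) (app br (sc l) x z) := by
  have h0 := congrArg α (hL.jacobi x y z l u)
  rw [hadd] at h0
  have h1 := hα x (app br (sc u) y z) l
  have h2 := hα (app br (sc l) x y) z (l + u)
  have h3 := hα y (app br (sc l) x z) u
  have h4 := congrArg (app br (sc l) x) (hα y z u)
  have h5 := congrArg (fun w => app br (sc (l + u)) w z) (hα x y l)
  have h6 := congrArg (app br (sc u) y) (hα x z l)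
  simp only [app_add_right, app_smul_right, app_add_left, app_smul_left] at h4 h5 h6
  have j1 := hL.jacobi (α x) y z l u
  have j2 := hL.jacobi x (α y) z l u
  have j3 := hL.jacobi x y (α z) l u
  linear_combination (norm := module) (4 : ℂ) • h0 - (2 : ℂ) • h1 + (2 : ℂ) • h2 + (2 : ℂ) • h3
    - h4 + h5 + h6 - j1 - j2 - j3

/-- If `(L, ∘_λ, [·_λ·])` is a transposed Poisson conformal
algebra and `h ∈ L`, then with `α_h x = (h ∘_λ x)|_{λ=0}`, the triple
`(L, [·_λ·], α_h)` is a Hom-Lie conformal algebra. -/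
theorem tpca_homLie {L : Type*} [AddCommGroup L] [Module ℂ L]
    (D : Module.End ℂ L) (m br : L →ₗ[ℂ] L →ₗ[ℂ] (ℕ →₀ L))
    (hT : IsTPCA D m br) (h : L) :
    IsHomLieConfAlg D br (fun x => app m (sc 0) h x) := by
  have hα : ∀ (y z : L) (u : ℂ), (2 : ℂ) • app m (sc 0) h (app br (sc u) y z) =
      app br (sc u) (app m (sc 0) h y) z + app br (sc u) y (app m (sc 0) h z) := fun y z u => by
    simpa only [zero_add] using hT.tLeibniz h y z 0 u
  exact
    { map_add := app_add_right m (sc 0) h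
      map_smul := fun c x => app_smul_right m (sc 0) c h x
      comm_D := fun x => by
        simpa only [zero_smul, add_zero] using hT.commAssoc.sesq_right h x 0
      sesq_left := hT.lie.sesq_left
      skew := hT.lie.skew
      homJacobi := hT.lie.homJacobi_of_leibniz (app_add_right m (sc 0) h) hα }

end ConfFormal
end
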